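/- For every integer m ≥ 1, one has (2m)!·A_{2m+1} = (1/2)·B_{2m}·(1 + 1/(2m)), where A_n = Σ_{k=1}^{n} (B(k)/(k!·k))·(B(n−k)/(n−k)!) and B(j) are the Bernoulli numbers with B(1) = +1/2 (so B_{2m} = B(2m) is the usual Bernoulli number). -/

import Mathlib

open Finset

/-- The convolution `A_n = Σ_{k+j=n, k≥1, j≥0} (B(k)/(k!·k))·(B(j)/j!)` where `B` are the
Bernoulli numbers with the convention `B(1) = +1/2` (Mathlib's `bernoulli'`). -/
noncomputable def convA (n : ℕ) : ℚ :=
  ∑ k ∈ Finset.Icc 1 n,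
    bernoulli' k / ((Nat.factorial k : ℚ) * k) *
      (bernoulli' (n - k) / (Nat.factorial (n - k) : ℚ))

/-- For every integer `m ≥ 1`, `(2m)!·A_{2m+1} = (1/2)·B_{2m}·(1 + 1/(2m))`, where `B_{2m}`
is the usual Bernoulli number of even index. -/
theorem factorial_mul_convA_odd (m : ℕ) (hm : 1 ≤ m) :
    (Nat.factorial (2 * m) : ℚ) * convA (2 * m + 1)
      = (1 / 2) * bernoulli (2 * m) * (1 + 1 / (2 * m : ℚ)) := by
  have hsum : convA (2 * m + 1) = ∑ k ∈ ({1, 2 * m} : Finset ℕ),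
      bernoulli' k / ((Nat.factorial k : ℚ) * k) *
        (bernoulli' (2 * m + 1 - k) / (Nat.factorial (2 * m + 1 - k) : ℚ)) := by
    unfold convA
    symm
    apply Finset.sum_subset
    · intro k hk
      simp only [Finset.mem_insert, Finset.mem_singleton] at hk
      simp only [Finset.mem_Icc]
      omega
    · intro k hk hk'
      simp only [Finset.mem_insert, Finset.mem_singleton, not_or] at hk'
      simp only [Finset.mem_Icc] at hk
      rcases Nat.even_or_odd k with he | ho
      · have h1 : Odd (2 * m + 1 - k) := by
          obtain ⟨r, hr⟩ := he
          exact ⟨m - r, by omega⟩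
        have h2 : 1 < 2 * m + 1 - k := by
          obtain ⟨r, hr⟩ := he
          omega
        rw [bernoulli'_eq_zero_of_odd h1 h2]
        simp
      · rw [bernoulli'_eq_zero_of_odd ho (by omega)]
        simp
  have hne : (1 : ℕ) ≠ 2 * m := by omega
  have hs : 2 * m + 1 - 2 * m = 1 := by omega
  have hm0 : (m : ℚ) ≠ 0 := by
    have : m ≠ 0 := by omega
    exact_mod_cast this
  have hf : (Nat.factorial (2 * m) : ℚ) ≠ 0 := by
    exact_mod_cast Nat.factorial_ne_zero _
  rw [hsum, Finset.sum_pair hne, hs, Nat.add_sub_cancel,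
    bernoulli_eq_bernoulli'_of_ne_one hne.symm, bernoulli'_one]
  simp only [Nat.factorial_one, Nat.cast_one, Nat.cast_mul, Nat.cast_ofNat]
  field_simp
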